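/- Let F be a field. The Demazure atoms {π̄_w(x_{D(w)}) : w ∈ 𝔖_n} form a free basis of F[x_1,…,x_n] as a module over the subring F[x]^{𝔖_n} of symmetric polynomials. (Established in the proof of Theorem 4.4 via Lemmas 4.1 and 4.3.) -/

import Mathlib

open MvPolynomial

/-- Value of a permutation of `Fin n` as a function `ℕ → ℕ` (0 outside range). -/
def pval {n : ℕ} (w : Equiv.Perm (Fin n)) (i : ℕ) : ℕ :=
  if h : i < n then (w ⟨i, h⟩ : ℕ) else 0

/-- 0-based descent set of `w`: `i ∈ permDes w` iff `w(i) > w(i+1)`, `0 ≤ i ≤ n-2`.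
(This corresponds to the 1-based descent `i+1` of the paper.) -/
def permDes {n : ℕ} (w : Equiv.Perm (Fin n)) : Finset ℕ :=
  (Finset.range (n - 1)).filter fun i => pval w (i + 1) < pval w i

/-- Number of inversions = Coxeter length of `w`. -/
def invNum {n : ℕ} (w : Equiv.Perm (Fin n)) : ℕ :=
  (Finset.univ.filter fun p : Fin n × Fin n => p.1 < p.2 ∧ w p.2 < w p.1).card

/-- The simple transposition `s_i = (i, i+1)` (0-based); identity if out of range. -/
def sw (n : ℕ) (i : ℕ) : Equiv.Perm (Fin n) :=
  if h : i + 1 < n then Equiv.swap ⟨i, Nat.lt_of_succ_lt h⟩ ⟨i + 1, h⟩ else 1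

/-- Exponent vector of `x_I = ∏_{i ∈ I} (x_0 x_1 ⋯ x_i)`. -/
def expI (n : ℕ) (I : Finset ℕ) : Fin n → ℕ := fun j => (I.filter fun i => (j : ℕ) ≤ i).card

/-- The monomial `x_I = ∏_{i ∈ I} (x_0 x_1 ⋯ x_i)`. -/
noncomputable def xI (R : Type*) [CommRing R] (n : ℕ) (I : Finset ℕ) :
    MvPolynomial (Fin n) R :=
  ∏ j : Fin n, (X j) ^ expI n I j

/-- `λ(d)`: the decreasing rearrangement of an exponent vector. -/
def lam {n : ℕ} (d : Fin n → ℕ) : List ℕ := (List.ofFn d).insertionSort (· ≥ ·)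

/-- `x^d ≺ x^e` : `λ(d)` lexicographically smaller than `λ(e)`. -/
def monLT {n : ℕ} (d e : Fin n → ℕ) : Prop := List.Lex (· < ·) (lam d) (lam e)

/-- 0-based descent set `D(α)` of a composition `α` of `n`:
`{α_1 + ⋯ + α_j - 1 : 1 ≤ j ≤ ℓ(α) - 1}` (0-based shift of the paper's `D(α)`). -/
def compDes {n : ℕ} (c : Composition n) : Finset ℕ :=
  (Finset.range (c.length - 1)).image fun j => c.sizeUpTo (j + 1) - 1

/-- The monomial with exponent vector `d`. -/
noncomputable def vecMon (F : Type*) [CommRing F] {n : ℕ} (d : Fin n → ℕ) :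
    MvPolynomial (Fin n) F := ∏ j, X j ^ d j

/-- The sum of `max (d p) (d q)` over all ordered pairs of positions; a symmetric, sublinear
statistic that is strictly decreasing along dominance order. -/
def pairMax {n : ℕ} (d : Fin n → ℕ) : ℕ := ∑ p, ∑ q, max (d p) (d q)

/-- A linear statistic on exponent vectors favouring early positions. -/
def earlyWeight {n : ℕ} (d : Fin n → ℕ) : ℕ := ∑ p : Fin n, (n - (p : ℕ)) * d p

/-- The indicator vector of a set of positions. -/
def indVec {n : ℕ} (S : Finset (Fin n)) : Fin n → ℕ := fun p => if p ∈ S then 1 else 0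

/-- The vector `e` with the entries at `i` and `j` replaced by `c` and `d`. -/
def replaceTwo {n : ℕ} (e : Fin n → ℕ) (i j : Fin n) (c d : ℕ) : Fin n → ℕ :=
  fun p => if p = i then c else if p = j then d else e p

/-- The span of the monomials whose `pairMax` is smaller than `k`. -/
noncomputable def lowSpan (F : Type*) [CommRing F] (n k : ℕ) :
    Submodule F (MvPolynomial (Fin n) F) :=
  Submodule.span F {f | ∃ d : Fin n → ℕ, pairMax d < k ∧ f = vecMon F d}

section Statistics

variable {n : ℕ}

theorem pairMax_add_le (d e : Fin n → ℕ) : pairMax (d + e) ≤ pairMax d + pairMax e := by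
  simp only [pairMax, ← Finset.sum_add_distrib, Pi.add_apply]
  exact Finset.sum_le_sum fun p _ => Finset.sum_le_sum fun q _ => by omega

theorem pairMax_add_lt (d e : Fin n → ℕ) (i j : Fin n) (hd : d i < d j) (he : e j < e i) :
    pairMax (d + e) < pairMax d + pairMax e := by
  simp only [pairMax, ← Finset.sum_add_distrib, Pi.add_apply]
  refine Finset.sum_lt_sum (fun p _ => Finset.sum_le_sum fun q _ => by omega)
    ⟨i, Finset.mem_univ _, ?_⟩
  exact Finset.sum_lt_sum (fun q _ => by omega) ⟨j, Finset.mem_univ _, by omega⟩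

theorem pairMax_smul (k : ℕ) (d : Fin n → ℕ) : pairMax (k • d) = k * pairMax d := by
  simp only [pairMax, Finset.mul_sum, Pi.smul_apply, smul_eq_mul, Nat.mul_max_mul_left]

theorem pairMax_comp (d : Fin n → ℕ) (σ : Equiv.Perm (Fin n)) :
    pairMax (d ∘ σ) = pairMax d := by
  simp only [pairMax, Function.comp_apply]
  rw [← Equiv.sum_comp σ (fun p => ∑ q, max (d p) (d q))]
  exact Finset.sum_congr rfl fun p _ => Equiv.sum_comp σ (fun q => max (d (σ p)) (d q))

theorem earlyWeight_add (d e : Fin n → ℕ) :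
    earlyWeight (d + e) = earlyWeight d + earlyWeight e := by
  simp [earlyWeight, mul_add, Finset.sum_add_distrib]

theorem earlyWeight_indVec (S : Finset (Fin n)) :
    earlyWeight (indVec S) = ∑ p ∈ S, (n - (p : ℕ)) := by
  simp [earlyWeight, indVec]

theorem pairMax_indVec (S : Finset (Fin n)) :
    pairMax (indVec S) = S.card * n + (n - S.card) * S.card := by
  have h : ∀ p, ∑ q, max (indVec S p) (indVec S q) = if p ∈ S then n else S.card := by
    intro p
    by_cases hp : p ∈ S
    · have : ∀ q, max (indVec S p) (indVec S q) = 1 := by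
        intro q; by_cases hq : q ∈ S <;> simp [indVec, hp, hq]
      simp [this, hp]
    · have : ∀ q, max (indVec S p) (indVec S q) = if q ∈ S then 1 else 0 := by
        intro q; by_cases hq : q ∈ S <;> simp [indVec, hp, hq]
      simp [this, hp]
  simp only [pairMax, h, Finset.sum_ite, Finset.sum_const, smul_eq_mul]
  have h2 : (Finset.univ.filter fun p => p ∉ S).card = n - S.card := by
    rw [Finset.filter_not, Finset.card_sdiff]
    simp
  rw [h2]
  simp

theorem replaceTwo_self (e : Fin n → ℕ) (i j : Fin n) : replaceTwo e i j (e i) (e j) = e := by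
  funext p; simp only [replaceTwo]; split_ifs <;> simp_all

theorem replaceTwo_swap (e : Fin n → ℕ) (i j : Fin n) :
    replaceTwo e i j (e j) (e i) = e ∘ Equiv.swap i j := by
  funext p; simp only [replaceTwo, Function.comp_apply, Equiv.swap_apply_def]
  split_ifs <;> simp_all

theorem pairMax_replaceTwo_lt (e : Fin n → ℕ) {i j : Fin n} (b k l : ℕ)
    (hk : 0 < k) (hl : 0 < l) (hi : e i = b + k + l) (hj : e j = b) :
    pairMax (replaceTwo e i j (b + k) (b + l)) < pairMax e := by
  have h : (k + l) • replaceTwo e i j (b + k) (b + l)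
      = k • e + l • (e ∘ Equiv.swap i j) := by
    rw [← replaceTwo_swap]
    funext p
    simp only [replaceTwo, Pi.smul_apply, Pi.add_apply, smul_eq_mul]
    split_ifs with h1 h2
    · subst h1; rw [hi, hj]; ring
    · subst h2; rw [hi, hj]; ring
    · ring
  have h2 := pairMax_add_lt (k • e) (l • (e ∘ Equiv.swap i j)) j i
    (by simp only [Pi.smul_apply, smul_eq_mul]; gcongr; omega)
    (by simp only [Pi.smul_apply, smul_eq_mul, Function.comp_apply, Equiv.swap_apply_left,
          Equiv.swap_apply_right]; gcongr; omega)
  rw [← h, pairMax_smul, pairMax_smul, pairMax_smul, pairMax_comp, ← add_mul] at h2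
  exact lt_of_mul_lt_mul_left h2 (Nat.zero_le _)

theorem pairMax_add_indVec (d : Fin n → ℕ) (S : Finset (Fin n))
    (h : ∀ i ∈ S, ∀ j ∉ S, d j ≤ d i) :
    pairMax (d + indVec S) = pairMax d + pairMax (indVec S) := by
  simp only [pairMax, ← Finset.sum_add_distrib, Pi.add_apply]
  refine Finset.sum_congr rfl fun p _ => Finset.sum_congr rfl fun q _ => ?_
  simp only [indVec]
  have h1 := h p
  have h2 := h q
  by_cases hp : p ∈ S <;> by_cases hq : q ∈ S <;> simp only [hp, hq, if_true, if_false]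
  · omega
  · have := h1 hp q hq; omega
  · have := h2 hq p hp; omega
  · omega

theorem sum_sub_lt_sum_sub {S t : Finset (Fin n)} (hcard : t.card = S.card) (hne : t ≠ S)
    (h : ∀ i ∈ S \ t, ∀ j ∈ t \ S, i < j) :
    ∑ p ∈ t, (n - (p : ℕ)) < ∑ p ∈ S, (n - (p : ℕ)) := by
  have hc : (t \ S).card = (S \ t).card := Finset.card_sdiff_comm hcard
  have hpos : (t \ S).Nonempty := by
    rw [Finset.sdiff_nonempty]
    exact fun hs => hne (Finset.eq_of_subset_of_card_le hs hcard.ge)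
  rw [← Finset.sum_inter_add_sum_sdiff t S, ← Finset.sum_inter_add_sum_sdiff S t,
    Finset.inter_comm S t]
  refine Nat.add_lt_add_left ?_ _
  set j₀ := (t \ S).min' hpos
  have hj : j₀ ∈ t \ S := Finset.min'_mem _ _
  have h1 : ∑ p ∈ t \ S, (n - (p : ℕ)) ≤ (t \ S).card • (n - (j₀ : ℕ)) :=
    Finset.sum_le_card_nsmul _ _ _ fun p hp => by
      have : (j₀ : ℕ) ≤ p := Finset.min'_le _ _ hp
      omega
  have h2 : (S \ t).card • (n - (j₀ : ℕ) + 1) ≤ ∑ p ∈ S \ t, (n - (p : ℕ)) :=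
    Finset.card_nsmul_le_sum _ _ _ fun p hp => by
      have h3 : (p : ℕ) < j₀ := h p hp _ hj
      have := j₀.2
      omega
  have h3 : 0 < (t \ S).card := Finset.card_pos.2 hpos
  rw [hc] at h1 h3
  simp only [smul_eq_mul, mul_add, mul_one] at h1 h2
  omega

/-- If `S` is an initial segment of the stable decreasing order of `d`, then adding to `d` the
indicator of any other set of the same size gives a smaller vector, first for `pairMax` and then
for `earlyWeight`. -/
theorem add_indVec_lt (d : Fin n → ℕ) {S t : Finset (Fin n)} (hcard : t.card = S.card)
    (hne : t ≠ S) (h : ∀ i ∈ S, ∀ j ∉ S, d j ≤ d i ∧ (d j = d i → i < j)) :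
    pairMax (d + indVec t) < pairMax (d + indVec S) ∨
      pairMax (d + indVec t) = pairMax (d + indVec S) ∧
        earlyWeight (d + indVec t) < earlyWeight (d + indVec S) := by
  have hH : pairMax (d + indVec S) = pairMax d + pairMax (indVec t) := by
    rw [pairMax_add_indVec d S fun i hi j hj => (h i hi j hj).1, pairMax_indVec, pairMax_indVec,
      hcard]
  rw [hH]
  rcases (pairMax_add_le d (indVec t)).lt_or_eq with hlt | heq
  · exact Or.inl hlt
  refine Or.inr ⟨heq, ?_⟩
  rw [earlyWeight_add, earlyWeight_add, earlyWeight_indVec, earlyWeight_indVec]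
  refine Nat.add_lt_add_left (sum_sub_lt_sum_sub hcard hne fun i hi j hj => ?_) _
  rw [Finset.mem_sdiff] at hi hj
  obtain ⟨h1, h2⟩ := h i hi.1 j hj.2
  refine h2 (le_antisymm h1 (not_lt.1 fun hlt => ?_))
  exact (pairMax_add_lt d (indVec t) j i hlt (by simp [indVec, hi.2, hj.1])).ne heq

end Statistics

section Monomials

variable {n : ℕ} {F : Type*} [Field F]

theorem vecMon_add (d e : Fin n → ℕ) : vecMon F (d + e) = vecMon F d * vecMon F e := by
  simp [vecMon, pow_add, Finset.prod_mul_distrib]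

theorem vecMon_indVec (S : Finset (Fin n)) : vecMon F (indVec S) = ∏ p ∈ S, X p := by
  simp [vecMon, indVec, pow_ite, Finset.prod_ite_mem]

theorem rename_vecMon (d : Fin n → ℕ) (σ : Equiv.Perm (Fin n)) :
    rename σ (vecMon F d) = vecMon F (d ∘ σ.symm) := by
  simp only [vecMon, map_prod, map_pow, rename_X, Function.comp_apply]
  rw [← Equiv.prod_comp σ fun j => X j ^ d (σ.symm j)]
  simp

theorem vecMon_mem_lowSpan {d : Fin n → ℕ} {k : ℕ} (h : pairMax d < k) :
    vecMon F d ∈ lowSpan F n k := Submodule.subset_span ⟨d, h, rfl⟩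

theorem lowSpan_mono {k l : ℕ} (h : k ≤ l) : lowSpan F n k ≤ lowSpan F n l :=
  Submodule.span_mono fun _ ⟨d, hd, e⟩ => ⟨d, hd.trans_le h, e⟩

theorem span_vecMon :
    Submodule.span F (Set.range (vecMon F : (Fin n → ℕ) → MvPolynomial (Fin n) F)) = ⊤ := by
  refine eq_top_iff.2 fun f _ => ?_
  induction f using MvPolynomial.induction_on' with
  | monomial u c =>
    have : monomial u c = c • vecMon F (u : Fin n → ℕ) := by
      rw [monomial_eq, vecMon, Finsupp.prod_fintype _ _ (by simp), smul_eq_C_mul]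
    rw [this]
    exact Submodule.smul_mem _ _ (Submodule.subset_span ⟨_, rfl⟩)
  | add p q hp hq => exact Submodule.add_mem _ (hp trivial) (hq trivial)

theorem vecMon_replaceTwo (e : Fin n → ℕ) {i j : Fin n} (hij : i ≠ j) (c d : ℕ) :
    vecMon F (replaceTwo e i j c d)
      = X i ^ c * X j ^ d * ∏ p ∈ (Finset.univ.erase i).erase j, X p ^ e p := by
  rw [vecMon, ← Finset.mul_prod_erase _ _ (Finset.mem_univ i),
    ← Finset.mul_prod_erase _ _ (Finset.mem_erase.2 ⟨hij.symm, Finset.mem_univ j⟩), ← mul_assoc]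
  congr 1
  · simp [replaceTwo, hij.symm]
  · refine Finset.prod_congr rfl fun p hp => ?_
    simp only [Finset.mem_erase] at hp
    simp [replaceTwo, hp.1, hp.2.1]

theorem vecMon_eq (e : Fin n → ℕ) {i j : Fin n} (hij : i ≠ j) :
    vecMon F e
      = X i ^ e i * X j ^ e j * ∏ p ∈ (Finset.univ.erase i).erase j, X p ^ e p := by
  rw [← vecMon_replaceTwo _ hij, replaceTwo_self]

end Monomials

section Demazure

variable {n : ℕ} {F : Type*} [Field F] {i j : Fin n}
  {D : MvPolynomial (Fin n) F → MvPolynomial (Fin n) F}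

theorem X_sub_X_ne_zero (hij : i ≠ j) : (X i - X j : MvPolynomial (Fin n) F) ≠ 0 :=
  sub_ne_zero.2 fun h => hij (X_injective h)

/-- An operator satisfying the Demazure relation, as a linear map. -/
noncomputable def demazureLin (hij : i ≠ j)
    (hD : ∀ f, (X i - X j) * D f = X i * f - X j * rename (Equiv.swap i j) f) :
    MvPolynomial (Fin n) F →ₗ[F] MvPolynomial (Fin n) F where
  toFun := D
  map_add' f g := mul_left_cancel₀ (X_sub_X_ne_zero hij) (by
    rw [mul_add, hD, hD, hD, map_add]; ring)
  map_smul' c f := mul_left_cancel₀ (X_sub_X_ne_zero hij) (by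
    rw [RingHom.id_apply, mul_smul_comm, hD, hD, map_smul, smul_sub, mul_smul_comm,
      mul_smul_comm])

theorem demazure_vecMon_ge (hij : i ≠ j)
    (hD : ∀ f, (X i - X j) * D f = X i * f - X j * rename (Equiv.swap i j) f)
    (e : Fin n → ℕ) (b m : ℕ) (hi : e i = b + m) (hj : e j = b) :
    D (vecMon F e)
      = ∑ k ∈ Finset.range (m + 1), vecMon F (replaceTwo e i j (b + k) (b + (m - k))) := by
  refine mul_left_cancel₀ (X_sub_X_ne_zero hij) ?_
  rw [hD, rename_vecMon, Equiv.symm_swap, ← replaceTwo_swap, vecMon_eq e hij]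
  simp only [vecMon_replaceTwo _ hij, hi, hj]
  have h := geom_sum₂_mul (X i : MvPolynomial (Fin n) F) (X j) (m + 1)
  simp only [Nat.add_sub_cancel] at h
  generalize (∏ p ∈ (Finset.univ.erase i).erase j, (X p : MvPolynomial (Fin n) F) ^ e p) = R
  have h2 : ∑ k ∈ Finset.range (m + 1),
      (X i : MvPolynomial (Fin n) F) ^ (b + k) * X j ^ (b + (m - k)) * R
      = X i ^ b * X j ^ b * R * ∑ k ∈ Finset.range (m + 1), X i ^ k * X j ^ (m - k) := by
    rw [Finset.mul_sum]
    exact Finset.sum_congr rfl fun k _ => by ring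
  rw [h2]
  linear_combination (-(X i ^ b * X j ^ b * R : MvPolynomial (Fin n) F)) * h

theorem demazure_vecMon_lt (hij : i ≠ j)
    (hD : ∀ f, (X i - X j) * D f = X i * f - X j * rename (Equiv.swap i j) f)
    (e : Fin n → ℕ) (b m : ℕ) (hi : e i = b) (hj : e j = b + m + 1) :
    D (vecMon F e) = -∑ k ∈ Finset.range m,
      vecMon F (replaceTwo e i j (b + (k + 1)) (b + (m - 1 - k + 1))) := by
  refine mul_left_cancel₀ (X_sub_X_ne_zero hij) ?_
  rw [hD, rename_vecMon, Equiv.symm_swap, ← replaceTwo_swap, vecMon_eq e hij]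
  simp only [vecMon_replaceTwo _ hij, hi, hj]
  have h := geom_sum₂_mul (X i : MvPolynomial (Fin n) F) (X j) m
  generalize (∏ p ∈ (Finset.univ.erase i).erase j, (X p : MvPolynomial (Fin n) F) ^ e p) = R
  have h2 : ∑ k ∈ Finset.range m,
      (X i : MvPolynomial (Fin n) F) ^ (b + (k + 1)) * X j ^ (b + (m - 1 - k + 1)) * R
      = X i ^ (b + 1) * X j ^ (b + 1) * R
        * ∑ k ∈ Finset.range m, X i ^ k * X j ^ (m - 1 - k) := by
    rw [Finset.mul_sum]
    exact Finset.sum_congr rfl fun k _ => by ring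
  rw [h2]
  linear_combination (X i ^ (b + 1) * X j ^ (b + 1) * R : MvPolynomial (Fin n) F) * h

theorem demazure_vecMon_lead (hij : i ≠ j)
    (hD : ∀ f, (X i - X j) * D f = X i * f - X j * rename (Equiv.swap i j) f)
    (e : Fin n → ℕ) (he : e j < e i) :
    D (vecMon F e) - vecMon F e - vecMon F (e ∘ Equiv.swap i j) ∈ lowSpan F n (pairMax e) := by
  obtain ⟨m, hm⟩ : ∃ m, e i = e j + (m + 1) := ⟨e i - e j - 1, by omega⟩
  rw [demazure_vecMon_ge hij hD e (e j) (m + 1) hm rfl, Finset.sum_range_succ,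
    Finset.sum_range_succ', ← replaceTwo_swap]
  have h1 : replaceTwo e i j (e j + (m + 1)) (e j + (m + 1 - (m + 1))) = e := by
    rw [Nat.sub_self, ← hm, add_zero, replaceTwo_self]
  have h2 : replaceTwo e i j (e j + 0) (e j + (m + 1 - 0)) = replaceTwo e i j (e j) (e i) := by
    rw [Nat.sub_zero, ← hm, add_zero]
  rw [h1, h2, add_sub_cancel_right, add_sub_cancel_right]
  refine Submodule.sum_mem _ fun k hk => vecMon_mem_lowSpan ?_
  rw [Finset.mem_range] at hk
  exact pairMax_replaceTwo_lt e (e j) (k + 1) _ (by omega) (by omega) (by omega) rfl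

theorem demazure_vecMon_mem (hij : i ≠ j)
    (hD : ∀ f, (X i - X j) * D f = X i * f - X j * rename (Equiv.swap i j) f)
    (e : Fin n → ℕ) {k : ℕ} (he : pairMax e < k) :
    D (vecMon F e) ∈ lowSpan F n k := by
  rcases lt_trichotomy (e i) (e j) with h | h | h
  · obtain ⟨m, hm⟩ : ∃ m, e j = e i + m + 1 := ⟨e j - e i - 1, by omega⟩
    rw [demazure_vecMon_lt hij hD e (e i) m rfl hm]
    refine Submodule.neg_mem _ (Submodule.sum_mem _ fun l hl => vecMon_mem_lowSpan ?_)
    rw [Finset.mem_range] at hl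
    refine lt_trans ?_ he
    have h2 := pairMax_replaceTwo_lt (i := i) (j := j) (e ∘ Equiv.swap i j) (e i) (l + 1) (m - 1 - l + 1)
      (by omega) (by omega) (by simp; omega) (by simp)
    rw [pairMax_comp] at h2
    refine lt_of_eq_of_lt (congrArg pairMax ?_) h2
    funext p
    simp only [replaceTwo]
    split_ifs with h3 h4
    · rfl
    · rfl
    · simp [Equiv.swap_apply_of_ne_of_ne h3 h4]
  · rw [demazure_vecMon_ge hij hD e (e j) 0 h rfl]
    have h1 : replaceTwo e i j (e j + 0) (e j + (0 - 0)) = e := by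
      have h2 := replaceTwo_self e i j
      rwa [h] at h2
    rw [zero_add, Finset.sum_range_one, h1]
    exact vecMon_mem_lowSpan he
  · have h1 := lowSpan_mono he.le (demazure_vecMon_lead hij hD e h)
    have h2 : vecMon F (e ∘ Equiv.swap i j) ∈ lowSpan F n k :=
      vecMon_mem_lowSpan (by rwa [pairMax_comp])
    have h3 : vecMon F e ∈ lowSpan F n k := vecMon_mem_lowSpan he
    have := add_mem (add_mem h1 h2) h3
    convert this using 1
    ring

theorem demazure_mem (hij : i ≠ j)
    (hD : ∀ f, (X i - X j) * D f = X i * f - X j * rename (Equiv.swap i j) f)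
    {k : ℕ} {f : MvPolynomial (Fin n) F} (hf : f ∈ lowSpan F n k) :
    D f ∈ lowSpan F n k := by
  have : lowSpan F n k ≤ (lowSpan F n k).comap (demazureLin hij hD) := by
    refine Submodule.span_le.2 ?_
    rintro _ ⟨d, hd, rfl⟩
    exact demazure_vecMon_mem hij hD d hd
  exact this hf

theorem demazure_sub_lead (hij : i ≠ j)
    (hD : ∀ f, (X i - X j) * D f = X i * f - X j * rename (Equiv.swap i j) f)
    (e : Fin n → ℕ) (he : e j < e i) {f : MvPolynomial (Fin n) F}
    (hf : f - vecMon F e ∈ lowSpan F n (pairMax e)) :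
    D f - f - vecMon F (e ∘ Equiv.swap i j) ∈ lowSpan F n (pairMax e) := by
  have h1 := demazure_vecMon_lead hij hD e he
  have h2 := demazure_mem hij hD hf
  have h3 : D (f - vecMon F e) = D f - D (vecMon F e) := (demazureLin hij hD).map_sub _ _
  rw [h3] at h2
  have := sub_mem (add_mem h1 h2) hf
  convert this using 1
  ring

end Demazure

section Inversions

variable {n : ℕ}

theorem sw_eq_swap {i : ℕ} (hi : i + 1 < n) :
    sw n i = Equiv.swap ⟨i, Nat.lt_of_succ_lt hi⟩ ⟨i + 1, hi⟩ := by simp [sw, hi]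

/-- An adjacent transposition of values creates at most one new inversion. -/
theorem inversion_of_sw_mul {i : ℕ} (hi : i + 1 < n) (v : Equiv.Perm (Fin n)) {p q : Fin n}
    (h : (sw n i * v) q < (sw n i * v) p) :
    v q < v p ∨ v p = ⟨i, Nat.lt_of_succ_lt hi⟩ ∧ v q = ⟨i + 1, hi⟩ := by
  rw [sw_eq_swap hi, Equiv.Perm.mul_apply, Equiv.Perm.mul_apply, Equiv.swap_apply_def,
    Equiv.swap_apply_def] at h
  simp only [Fin.ext_iff, Fin.lt_def] at h ⊢
  split_ifs at h <;> (try dsimp only at h) <;> omega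

theorem invNum_sw_mul_le {i : ℕ} (hi : i + 1 < n) (v : Equiv.Perm (Fin n)) :
    invNum (sw n i * v) ≤ invNum v + 1 := by
  refine (Finset.card_le_card ?_).trans (Finset.card_insert_le
    (v.symm ⟨i, Nat.lt_of_succ_lt hi⟩, v.symm ⟨i + 1, hi⟩) _)
  rintro ⟨p, q⟩ h
  simp only [Finset.mem_filter, Finset.mem_univ, true_and, Finset.mem_insert] at h ⊢
  rcases inversion_of_sw_mul hi v h.2 with h2 | ⟨h2, h3⟩
  · exact Or.inr ⟨h.1, h2⟩
  · left; rw [← h2, ← h3]; simp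

theorem lt_of_invNum_sw_mul {i : ℕ} (hi : i + 1 < n) (v : Equiv.Perm (Fin n))
    (h : invNum v < invNum (sw n i * v)) {p q : Fin n}
    (hp : v p = ⟨i, Nat.lt_of_succ_lt hi⟩) (hq : v q = ⟨i + 1, hi⟩) : p < q := by
  by_contra hpq
  refine absurd (Finset.card_le_card ?_) (not_le.2 h)
  rintro ⟨p', q'⟩ h
  simp only [Finset.mem_filter, Finset.mem_univ, true_and] at h ⊢
  rcases inversion_of_sw_mul hi v h.2 with h2 | ⟨h2, h3⟩
  · exact ⟨h.1, h2⟩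
  · rw [← v.injective (hp.trans h2.symm), ← v.injective (hq.trans h3.symm)] at h
    exact absurd h.1 hpq

theorem invNum_prod_le (l : List ℕ) (hl : ∀ i ∈ l, i + 1 < n) :
    invNum (l.map (sw n)).prod ≤ l.length := by
  induction l with
  | nil =>
    simp only [List.map_nil, List.prod_nil, List.length_nil, Nat.le_zero, invNum,
      Finset.card_eq_zero, Finset.filter_eq_empty_iff]
    rintro ⟨p, q⟩ - ⟨h1, h2⟩
    exact absurd h1 h2.not_gt
  | cons i l ih =>
    rw [List.forall_mem_cons] at hl
    rw [List.map_cons, List.prod_cons, List.length_cons]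
    exact (invNum_sw_mul_le hl.1 _).trans (Nat.succ_le_succ (ih hl.2))

end Inversions

/-- The leading term of a Demazure atom applied to a dominant monomial, along a reduced word of
a minimal coset representative of the stabilizer of the exponent. -/
theorem foldr_demazure_lead {n : ℕ} {F : Type*} [Field F]
    (dem : ℕ → MvPolynomial (Fin n) F → MvPolynomial (Fin n) F)
    (hdem : ∀ (i : ℕ) (hi : i + 1 < n) (f : MvPolynomial (Fin n) F),
      (X (⟨i, Nat.lt_of_succ_lt hi⟩ : Fin n) - X ⟨i + 1, hi⟩) * dem i f
        = X (⟨i, Nat.lt_of_succ_lt hi⟩ : Fin n) * f - X ⟨i + 1, hi⟩ * rename (sw n i) f)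
    (ν : Fin n → ℕ) (hν : Antitone ν) (l : List ℕ) (hl : ∀ i ∈ l, i + 1 < n)
    (hred : l.length = invNum (l.map (sw n)).prod)
    (hmin : ∀ p q, p < q → ν p = ν q → (l.map (sw n)).prod p < (l.map (sw n)).prod q) :
    l.foldr (fun i f => dem i f - f) (vecMon F ν)
      - vecMon F (ν ∘ ((l.map (sw n)).prod).symm) ∈ lowSpan F n (pairMax ν) := by
  induction l with
  | nil => simp [Equiv.Perm.one_def]
  | cons i l ih =>
    rw [List.forall_mem_cons] at hl
    obtain ⟨hi, hl⟩ := hl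
    rw [List.map_cons, List.prod_cons] at hred hmin ⊢
    rw [List.length_cons] at hred
    set v := (l.map (sw n)).prod with hv
    have h1 := invNum_sw_mul_le hi v
    have h2 : invNum v ≤ l.length := invNum_prod_le l hl
    have hlt : invNum v < invNum (sw n i * v) := by omega
    have hord := lt_of_invNum_sw_mul hi v hlt
      (p := v.symm ⟨i, Nat.lt_of_succ_lt hi⟩) (q := v.symm ⟨i + 1, hi⟩) (by simp) (by simp)
    have key := ih hl (by omega) fun p q hpq hν' => by
      by_contra hc
      have hc' : v q < v p := lt_of_le_of_ne (not_lt.1 hc) fun h => hpq.ne' (v.injective h)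
      have h3 : (sw n i * (sw n i * v)) q < (sw n i * (sw n i * v)) p := by
        rwa [← mul_assoc, sw_eq_swap hi, Equiv.swap_mul_self, one_mul]
      rcases inversion_of_sw_mul hi _ h3 with h4 | ⟨h4, h5⟩
      · exact absurd h4 (hmin p q hpq hν').not_gt
      · rw [sw_eq_swap hi, Equiv.Perm.mul_apply, Equiv.swap_apply_eq_iff,
          Equiv.swap_apply_left] at h4
        rw [sw_eq_swap hi, Equiv.Perm.mul_apply, Equiv.swap_apply_eq_iff,
          Equiv.swap_apply_right] at h5
        rw [← h4, ← h5, Equiv.symm_apply_apply, Equiv.symm_apply_apply] at hord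
        exact absurd hord hpq.not_gt
    have hij : (⟨i, Nat.lt_of_succ_lt hi⟩ : Fin n) ≠ ⟨i + 1, hi⟩ := by simp
    have hD := hdem i hi
    rw [sw_eq_swap hi] at hD
    have hdesc : (ν ∘ v.symm) ⟨i + 1, hi⟩ < (ν ∘ v.symm) ⟨i, Nat.lt_of_succ_lt hi⟩ := by
      refine lt_of_le_of_ne (hν hord.le) fun h => ?_
      have := hmin _ _ hord h.symm
      rw [sw_eq_swap hi] at this
      simp [Equiv.Perm.mul_apply] at this
    have hpm : pairMax (ν ∘ v.symm) = pairMax ν := pairMax_comp _ _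
    rw [← hpm] at key ⊢
    have h := demazure_sub_lead hij hD (ν ∘ v.symm) hdesc key
    rw [List.foldr_cons]
    convert h using 3
    rw [sw_eq_swap hi]
    rfl

section DescentExponent

variable {n : ℕ}

theorem expI_antitone (I : Finset ℕ) : Antitone (expI n I) := fun p q hpq =>
  Finset.card_le_card fun i hi => by
    rw [Finset.mem_filter] at hi ⊢
    exact ⟨hi.1, le_trans (Fin.le_def.1 hpq) hi.2⟩

theorem expI_succ (I : Finset ℕ) (p : ℕ) (hp : p + 1 < n) :
    expI n I ⟨p, Nat.lt_of_succ_lt hp⟩ = expI n I ⟨p + 1, hp⟩ + if p ∈ I then 1 else 0 := by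
  simp only [expI]
  have h : I.filter (fun i => p ≤ i)
      = I.filter (fun i => p + 1 ≤ i) ∪ I.filter (fun i => i = p) := by
    ext x; simp only [Finset.mem_union, Finset.mem_filter]
    constructor
    · rintro ⟨h1, h2⟩
      rcases h2.eq_or_lt with h | h
      · exact Or.inr ⟨h1, h.symm⟩
      · exact Or.inl ⟨h1, h⟩
    · rintro (⟨h1, h2⟩ | ⟨h1, h2⟩) <;> exact ⟨h1, by omega⟩
  rw [h, Finset.card_union_of_disjoint]
  · congr 1
    rw [Finset.filter_eq']
    split_ifs <;> simp
  · rw [Finset.disjoint_left]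
    intro x h1 h2
    rw [Finset.mem_filter] at h1 h2
    omega

theorem mem_permDes (w : Equiv.Perm (Fin n)) (p : ℕ) (hp : p + 1 < n) :
    p ∈ permDes w ↔ w ⟨p + 1, hp⟩ < w ⟨p, Nat.lt_of_succ_lt hp⟩ := by
  rw [permDes, Finset.mem_filter, Finset.mem_range, pval, pval, dif_pos hp,
    dif_pos (Nat.lt_of_succ_lt hp), Fin.lt_def]
  constructor
  · exact fun h => h.2
  · exact fun h => ⟨by omega, h⟩

theorem expI_permDes_last (w : Equiv.Perm (Fin n)) (p : Fin n) (hp : (p : ℕ) + 1 = n) :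
    expI n (permDes w) p = 0 := by
  simp only [expI, Finset.card_eq_zero, Finset.filter_eq_empty_iff]
  intro i hi
  simp only [permDes, Finset.mem_filter, Finset.mem_range] at hi
  omega

/-- A permutation is increasing on the level sets of the exponent of `x_{D(w)}`. -/
theorem lt_of_expI_permDes_eq (w : Equiv.Perm (Fin n)) (p q : Fin n) (hpq : p < q)
    (h : expI n (permDes w) p = expI n (permDes w) q) : w p < w q := by
  obtain ⟨q, hq⟩ := q
  induction q with
  | zero => exact absurd hpq (by simp [Fin.lt_def])
  | succ q ih =>
    have hq' := Nat.lt_of_succ_lt hq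
    have hpq' : p ≤ ⟨q, hq'⟩ := by
      rw [Fin.lt_def] at hpq; rw [Fin.le_def]; simp only at hpq ⊢; omega
    have h1 := expI_antitone (permDes w) hpq'
    have h2 := expI_succ (permDes w) q hq
    have h3 : q ∉ permDes w := fun hc => by rw [if_pos hc] at h2; omega
    rw [if_neg h3] at h2
    rw [mem_permDes w q hq, not_lt] at h3
    have h4 : w ⟨q, hq'⟩ < w ⟨q + 1, hq⟩ :=
      lt_of_le_of_ne h3 fun hc => by simpa using w.injective hc
    rcases hpq'.eq_or_lt with h5 | h5
    · rwa [h5]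
    · exact (ih hq' h5 (by omega)).trans h4

end DescentExponent

/-- Either an exponent vector is that of a descent monomial, or it arises from a smaller one by
adding the indicator of an initial segment of its stable decreasing order. -/
theorem descent_or_reducible {n : ℕ} (d : Fin n → ℕ) :
    (∃ w : Equiv.Perm (Fin n), d = expI n (permDes w) ∘ w.symm) ∨
      ∃ (S : Finset (Fin n)) (d' : Fin n → ℕ), S.Nonempty ∧ d = d' + indVec S ∧
        ∀ i ∈ S, ∀ j ∉ S, d' j ≤ d' i ∧ (d' j = d' i → i < j) := by
  obtain ⟨w, hmono, hstab⟩ : ∃ w : Equiv.Perm (Fin n), Antitone (d ∘ w) ∧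
      ∀ i j, i < j → d (w i) = d (w j) → w i < w j := by
    have h := (Tuple.eq_sort_iff (f := fun i => OrderDual.toDual (d i))).1 rfl
    exact ⟨_, fun i j hij => h.1 hij, fun i j hij he => h.2 i j hij (congrArg _ he)⟩
  by_cases hred : ∃ p : Fin n, 0 < d (w p) ∧ ∀ h : (p : ℕ) + 1 < n,
      d (w ⟨p + 1, h⟩) + (if (p : ℕ) ∈ permDes w then 1 else 0) < d (w p)
  · right
    obtain ⟨p, hp0, hp⟩ := hred
    have hS : ∀ i, i ∈ Finset.univ.filter (fun i => w.symm i ≤ p) ↔ w.symm i ≤ p := by simp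
    set S := Finset.univ.filter (fun i => w.symm i ≤ p)
    have hd : ∀ i, w.symm i ≤ p → d (w p) ≤ d i := fun i hi => by
      simpa using hmono hi
    refine ⟨S, fun i => d i - indVec S i, ⟨w p, (hS _).2 (by simp)⟩, ?_, ?_⟩
    · funext i
      simp only [Pi.add_apply, indVec]
      split_ifs with hi
      · have := hd i ((hS i).1 hi); omega
      · omega
    · intro i hi j hj
      simp only [indVec, hi, hj, if_true, if_false]
      rw [hS] at hi hj
      have h1 := hd i hi
      rw [not_le] at hj
      have hlt : (p : ℕ) + 1 < n := lt_of_le_of_lt (Nat.succ_le_of_lt hj) (w.symm j).2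
      have hle : (⟨p + 1, hlt⟩ : Fin n) ≤ w.symm j := Nat.succ_le_of_lt hj
      have h2 : d j ≤ d (w ⟨p + 1, hlt⟩) := by simpa using hmono hle
      have h3 := hp hlt
      refine ⟨by omega, fun he => ?_⟩
      by_cases hdes : (p : ℕ) ∈ permDes w
      · rw [if_pos hdes] at h3; omega
      · rw [mem_permDes w p hlt, not_lt] at hdes
        have h4 : w.symm i = p ∨ i < w p := by
          rcases hi.eq_or_lt with h | h
          · exact Or.inl h
          · right; simpa using hstab _ _ h (by simp; omega)
        have h5 : w.symm j = ⟨p + 1, hlt⟩ ∨ w ⟨p + 1, hlt⟩ < j := by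
          rcases hle.eq_or_lt with h | h
          · exact Or.inl h.symm
          · right; simpa using hstab _ _ h (by simp; omega)
        have h6 : i ≤ w p := by
          rcases h4 with h | h
          · rw [← h]; simp
          · exact h.le
        have h7 : w ⟨p + 1, hlt⟩ ≤ j := by
          rcases h5 with h | h
          · rw [← h]; simp
          · exact h.le
        refine lt_of_le_of_ne (h6.trans (hdes.trans h7)) ?_
        rintro rfl
        exact absurd hi hj.not_ge
  · left
    push Not at hred
    refine ⟨w, ?_⟩
    suffices h : ∀ (k : ℕ) (p : Fin n), n - (p : ℕ) = k → d (w p) = expI n (permDes w) p by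
      funext i
      simpa using h _ (w.symm i) rfl
    intro k
    induction k with
    | zero => intro p hp; have := p.2; omega
    | succ k ih =>
      intro p hp
      by_cases hlt : (p : ℕ) + 1 < n
      · have h1 := ih ⟨p + 1, hlt⟩ (by simp only; omega)
        have h2 := expI_succ (permDes w) p hlt
        simp only [Fin.eta] at h2
        have hanti : d (w ⟨p + 1, hlt⟩) ≤ d (w p) :=
          hmono (Fin.le_def.2 (Nat.le_succ _))
        have h3 : p < ⟨p + 1, hlt⟩ := Fin.lt_def.2 (Nat.lt_succ_self _)
        have h4 : (p : ℕ) ∈ permDes w → d (w ⟨p + 1, hlt⟩) < d (w p) := fun hdes =>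
          lt_of_le_of_ne hanti fun he =>
            absurd (hstab _ _ h3 he.symm) ((mem_permDes w p hlt).1 hdes).not_gt
        have h5 : d (w p) ≤ d (w ⟨p + 1, hlt⟩) + (if (p : ℕ) ∈ permDes w then 1 else 0) := by
          rcases Nat.eq_zero_or_pos (d (w p)) with h | h
          · omega
          · exact (hred p h).2
        split_ifs at h2 h5 with hdes
        · have := h4 hdes; omega
        · omega
      · rw [expI_permDes_last w p (by have := p.2; omega)]
        rcases Nat.eq_zero_or_pos (d (w p)) with h | h
        · exact h
        · exact absurd (hred p h).1 hlt

/-- A family of `n!` elements spanning the polynomial ring over the symmetric polynomials is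
linearly independent. -/
theorem linearIndependent_of_span_symmetric {n : ℕ} {F : Type*} [Field F]
    (a : Equiv.Perm (Fin n) → MvPolynomial (Fin n) F)
    (hspan : Submodule.span (symmetricSubalgebra (Fin n) F) (Set.range a) = ⊤) :
    LinearIndependent (symmetricSubalgebra (Fin n) F) a := by
  let M : Matrix (Equiv.Perm (Fin n)) (Equiv.Perm (Fin n)) (MvPolynomial (Fin n) F) :=
    Matrix.of fun σ w => rename σ (a w)
  have hsym : ∀ (σ : Equiv.Perm (Fin n)) (c : symmetricSubalgebra (Fin n) F)
      (f : MvPolynomial (Fin n) F), rename σ (c • f) = (c : MvPolynomial (Fin n) F) * rename σ f :=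
    fun σ c f => by rw [Subalgebra.smul_def, smul_eq_mul, map_mul, c.2 σ]
  have hdet : M.det ≠ 0 := by
    rw [Ne, ← Matrix.exists_vecMul_eq_zero_iff]
    rintro ⟨v, hv, hM⟩
    refine hv ?_
    have hall : ∀ f, ∑ σ, v σ * rename σ f = 0 := by
      intro f
      have hf : f ∈ Submodule.span (symmetricSubalgebra (Fin n) F) (Set.range a) :=
        hspan ▸ trivial
      induction hf using Submodule.span_induction with
      | mem x hx =>
        obtain ⟨w, rfl⟩ := hx
        exact congrFun hM w
      | zero => simp
      | add x y _ _ hx hy => simp [mul_add, Finset.sum_add_distrib, hx, hy]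
      | smul c x _ hx =>
        simp only [hsym, mul_left_comm _ (c : MvPolynomial (Fin n) F), ← Finset.mul_sum, hx,
          mul_zero]
    let φ : Equiv.Perm (Fin n) → (MvPolynomial (Fin n) F →* MvPolynomial (Fin n) F) :=
      fun σ => ((rename σ : MvPolynomial (Fin n) F →ₐ[F] _) : _ →* _)
    have hφ : Function.Injective φ := fun σ τ h => by
      ext p : 1
      have := DFunLike.congr_fun h (X p)
      simpa [φ, X_injective.eq_iff] using this
    have hli := (linearIndependent_monoidHom (MvPolynomial (Fin n) F)
      (MvPolynomial (Fin n) F)).comp φ hφ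
    rw [Fintype.linearIndependent_iff] at hli
    refine funext (hli v ?_)
    funext f
    simpa [φ] using hall f
  rw [Fintype.linearIndependent_iff]
  intro c hc w
  have h0 : (fun w => (c w : MvPolynomial (Fin n) F)) = 0 := by
    by_contra hne
    refine hdet (Matrix.exists_mulVec_eq_zero_iff.1 ⟨_, hne, funext fun σ => ?_⟩)
    have := congrArg (rename σ) hc
    simp only [map_sum, hsym, map_zero] at this
    simpa [Matrix.mulVec, dotProduct, M, mul_comm] using this
  exact Subtype.ext (congrFun h0 w)

/-- **From the proof of Theorem 4.4.**  The Demazure atoms `π̄_w(x_{D(w)})` (here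
`a w = π̄_{i_1} ∘ ⋯ ∘ π̄_{i_k} (x_{D(w)})` for a reduced word `w = s_{i_1} ⋯ s_{i_k}`, where
the Demazure operators `π_i` are characterized by
`(x_i - x_{i+1}) π_i f = x_i f - x_{i+1} s_i(f)` and `π̄_i = π_i - 1`) form a free basis of
`F[x]` as a module over the subring `F[x]^{𝔖_n}` of symmetric polynomials. -/
theorem stmt_5 (n : ℕ) (hn : 1 ≤ n) (F : Type*) [Field F]
    (dem : ℕ → MvPolynomial (Fin n) F → MvPolynomial (Fin n) F)
    (hdem : ∀ (i : ℕ) (hi : i + 1 < n) (f : MvPolynomial (Fin n) F),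
      (X (⟨i, Nat.lt_of_succ_lt hi⟩ : Fin n) - X ⟨i + 1, hi⟩) * dem i f
        = X (⟨i, Nat.lt_of_succ_lt hi⟩ : Fin n) * f - X ⟨i + 1, hi⟩ * rename (sw n i) f)
    (a : Equiv.Perm (Fin n) → MvPolynomial (Fin n) F)
    (ha : ∀ w : Equiv.Perm (Fin n), ∃ l : List ℕ,
      (∀ i ∈ l, i + 1 < n) ∧ (l.map (sw n)).prod = w ∧ l.length = invNum w ∧
      a w = l.foldr (fun i f => dem i f - f) (xI F n (permDes w))) :
    LinearIndependent (symmetricSubalgebra (Fin n) F) a ∧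
    Submodule.span (symmetricSubalgebra (Fin n) F) (Set.range a) = ⊤ := by
  have hlead : ∀ w : Equiv.Perm (Fin n), a w - vecMon F (expI n (permDes w) ∘ w.symm) ∈
      lowSpan F n (pairMax (expI n (permDes w))) := by
    intro w
    obtain ⟨l, hl, hw, hlen, hal⟩ := ha w
    have := foldr_demazure_lead dem hdem (expI n (permDes w)) (expI_antitone _) l hl
      (by rw [hw, hlen]) (by rw [hw]; exact lt_of_expI_permDes_eq w)
    rw [hw] at this
    rw [hal]
    exact this
  set N := Submodule.span (symmetricSubalgebra (Fin n) F) (Set.range a) with hN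
  have hmon : ∀ d : Fin n → ℕ, vecMon F d ∈ N := by
    intro d
    induction hk : toLex (pairMax d, earlyWeight d) using WellFoundedLT.induction generalizing d with
    | ind k ih =>
    subst hk
    have ih' : ∀ e : Fin n → ℕ, (pairMax e < pairMax d ∨
        pairMax e = pairMax d ∧ earlyWeight e < earlyWeight d) → vecMon F e ∈ N :=
      fun e he => ih _ (Prod.Lex.toLex_lt_toLex.2 he) e rfl
    rcases descent_or_reducible d with ⟨w, rfl⟩ | ⟨S, d', hS, rfl, hd'⟩
    · have hlow : lowSpan F n (pairMax (expI n (permDes w))) ≤ N.restrictScalars F := by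
        refine Submodule.span_le.2 ?_
        rintro _ ⟨e, he, rfl⟩
        exact ih' e (Or.inl (by rwa [pairMax_comp]))
      have h1 : a w - vecMon F (expI n (permDes w) ∘ w.symm) ∈ N := hlow (hlead w)
      have h2 : a w ∈ N := Submodule.subset_span ⟨w, rfl⟩
      simpa using sub_mem h2 h1
    · have hpos : pairMax d' < pairMax (d' + indVec S) := by
        rw [pairMax_add_indVec d' S fun i hi j hj => (hd' i hi j hj).1, pairMax_indVec]
        have := Finset.card_pos.2 hS
        have : 0 < S.card * n := Nat.mul_pos this hn
        omega
      have h1 : (⟨esymm (Fin n) F S.card, esymm_isSymmetric _ _ _⟩ :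
          symmetricSubalgebra (Fin n) F) • vecMon F d' ∈ N :=
        Submodule.smul_mem _ _ (ih' d' (Or.inl hpos))
      change (∑ t ∈ Finset.powersetCard S.card Finset.univ, ∏ i ∈ t, X i) * vecMon F d' ∈ N at h1
      rw [Finset.sum_mul,
        ← Finset.add_sum_erase _ _ (Finset.mem_powersetCard.2 ⟨Finset.subset_univ S, rfl⟩)] at h1
      have hterm : ∀ t : Finset (Fin n), (∏ i ∈ t, X i) * vecMon F d' = vecMon F (d' + indVec t) :=
        fun t => by rw [vecMon_add, vecMon_indVec, mul_comm]
      simp only [hterm] at h1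
      refine (Submodule.add_mem_iff_left _ (Submodule.sum_mem _ fun t ht => ?_)).1 h1
      rw [Finset.mem_erase, Finset.mem_powersetCard] at ht
      exact ih' _ (add_indVec_lt d' ht.2.2 ht.1 hd')
  have hspan : N = ⊤ := by
    have h : (⊤ : Submodule F (MvPolynomial (Fin n) F)) ≤ N.restrictScalars F := by
      rw [← span_vecMon, Submodule.span_le]
      rintro _ ⟨d, rfl⟩
      exact hmon d
    exact eq_top_iff.2 fun f _ => h trivial
  exact ⟨linearIndependent_of_span_symmetric a hspan, hspan⟩
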